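/- Fix n ≥ 1 and 1 ≤ i ≤ n. Let f and g be continuously differentiable functions on ℝ^n such that the partial derivatives ∂_i f and ∂_i g are bounded. Then ∑_{j=1}^m I_{ij}(f̌_m)·I_{ij}(ǧ_m) → 4·E_μ[|∂_i f|]·E_μ[|∂_i g|] as m → ∞. -/

import Mathlib

open MeasureTheory ProbabilityTheory Filter Pointwise

noncomputable section

/-- The standard Gaussian measure on `ℝ`. -/
def stdGaussian : Measure ℝ := gaussianReal 0 1

/-- The `n`-fold product of the standard Gaussian measure on `ℝⁿ`. -/
def gaussianPi (n : ℕ) : Measure (Fin n → ℝ) := Measure.pi fun _ => stdGaussian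

/-- Lower Minkowski content of a set `S ⊆ ℝ` w.r.t. the standard Gaussian measure. -/
def minkContent (S : Set ℝ) : ℝ :=
  Filter.liminf
    (fun r : ℝ =>
      ((stdGaussian (S + Set.Icc (-r) r)).toReal - (stdGaussian S).toReal) / r)
    (nhdsWithin 0 (Set.Ioi 0))

/-- The restriction of `A` along the fiber of `x` in the `i`-th direction. -/
def fiber {n : ℕ} (A : Set (Fin n → ℝ)) (i : Fin n) (x : Fin n → ℝ) : Set ℝ :=
  {y : ℝ | Function.update x i y ∈ A}

/-- The geometric influence of coordinate `i` on `A`. -/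
def geomInfluence {n : ℕ} (A : Set (Fin n → ℝ)) (i : Fin n) : ℝ :=
  ∫ x, minkContent (fiber A i x) ∂(gaussianPi n)

/-- A set is increasing if its indicator is nondecreasing in each coordinate. -/
def IncreasingSet {n : ℕ} (A : Set (Fin n → ℝ)) : Prop :=
  ∀ ⦃x y : Fin n → ℝ⦄, x ≤ y → x ∈ A → y ∈ A

end


noncomputable section

/-- The `i`-th partial derivative of `f : ℝⁿ → ℝ` at `x`. -/
def pderiv {n : ℕ} (f : (Fin n → ℝ) → ℝ) (i : Fin n) (x : Fin n → ℝ) : ℝ :=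
  fderiv ℝ f x (Pi.single i 1)

end

noncomputable section

/-- The identification of `Bool` with `{−1, 1} ⊆ ℝ` (`true ↦ 1`, `false ↦ −1`). -/
def pm1 (b : Bool) : ℝ := if b then 1 else -1

/-- The influence of coordinate `k` on a function `F` on the discrete cube `{−1,1}^N`
(w.r.t. the uniform measure): `I_k(F) = E[|F(X) − F(X^{[k]})|]`. -/
def discInfluence {N : Type*} [Fintype N] [DecidableEq N]
    (F : (N → Bool) → ℝ) (k : N) : ℝ :=
  (∑ x : N → Bool, |F x - F (Function.update x k (!x k))|) /
    (Fintype.card (N → Bool) : ℝ)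

/-- The discretization `f̌_m : {−1,1}^{n×m} → ℝ` of `f : ℝⁿ → ℝ`, given by
`f̌_m(x) = f(s₁, …, s_n)` with `s_i = m^{−1/2} ∑_j x_{ij}`. -/
def cubeApprox {n : ℕ} (f : (Fin n → ℝ) → ℝ) (m : ℕ) :
    (Fin n × Fin m → Bool) → ℝ :=
  fun x => f (fun i => (∑ j : Fin m, pm1 (x (i, j))) / Real.sqrt m)

end


/-- The rescaled row sums. -/
noncomputable def rowSums {n : ℕ} (m : ℕ) (x : Fin n × Fin m → Bool) : Fin n → ℝ :=
  fun i => (∑ j : Fin m, pm1 (x (i, j))) / Real.sqrt m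

lemma tendsto_cos_pow (t : ℝ) :
    Tendsto (fun m : ℕ => (Complex.cos ((t / Real.sqrt m : ℝ) : ℂ)) ^ m) atTop
      (nhds (Complex.exp (-(t:ℂ) ^ 2 / 2))) := by
  have hX : AEMeasurable pm1 (PMF.uniformOfFintype Bool).toMeasure :=
    (Measurable.of_discrete).aemeasurable
  have h := tendsto_charFun_inv_sqrt_mul_pow (P := (PMF.uniformOfFintype Bool).toMeasure)
    (X := pm1) hX (by simp [PMF.integral_eq_sum, pm1]) (by rw [PMF.integral_eq_sum]; simp [pm1]) t
  refine h.congr fun m => ?_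
  congr 1
  rw [charFun_apply_real, integral_map hX (by fun_prop), PMF.integral_eq_sum]
  simp only [Fintype.sum_bool, pm1, PMF.uniformOfFintype_apply]
  rw [Complex.cos]
  simp only [Fintype.card_bool]
  simp
  ring_nf

lemma sum_exp_rowSums {n m : ℕ} (t : Fin n → ℝ) :
    (∑ x : Fin n × Fin m → Bool, Complex.exp ((∑ i, rowSums m x i * t i : ℝ) * Complex.I)) /
      (Fintype.card (Fin n × Fin m → Bool) : ℂ) =
    ∏ i, (Complex.cos ((t i / Real.sqrt m : ℝ) : ℂ)) ^ m := by
  have h1 : ∀ x : Fin n × Fin m → Bool,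
      Complex.exp ((∑ i, rowSums m x i * t i : ℝ) * Complex.I) =
      ∏ k : Fin n × Fin m, Complex.exp ((pm1 (x k) * (t k.1 / Real.sqrt m) : ℝ) * Complex.I) := by
    intro x
    rw [← Complex.exp_sum, ← Finset.sum_mul, ← Complex.ofReal_sum, Fintype.sum_prod_type]
    congr 3
    refine Finset.sum_congr rfl fun i _ => ?_
    simp only [rowSums]
    rw [div_mul_eq_mul_div, mul_div_assoc, Finset.sum_mul]
  simp_rw [h1]
  rw [← Fintype.prod_sum (fun (k : Fin n × Fin m) b => Complex.exp ((pm1 b * (t k.1 / Real.sqrt m) : ℝ) * Complex.I))]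
  have h2 : (Fintype.card (Fin n × Fin m → Bool) : ℂ) = ∏ k : Fin n × Fin m, (2:ℂ) := by simp
  rw [h2, ← Finset.prod_div_distrib, Fintype.prod_prod_type]
  refine Finset.prod_congr rfl fun i _ => ?_
  change ∏ y : Fin m, (∑ b, Complex.exp ((pm1 b * (t i / Real.sqrt m) : ℝ) * Complex.I)) / 2 = _
  rw [Finset.prod_const, Finset.card_univ, Fintype.card_fin]
  congr 1
  simp only [Fintype.sum_bool, pm1]
  rw [Complex.cos]
  simp

lemma weak_conv (n : ℕ) (h : (Fin n → ℝ) → ℝ) (hc : Continuous h) (C : ℝ) (hC : ∀ x, |h x| ≤ C) :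
    Tendsto (fun m : ℕ => (∑ x : Fin n × Fin m → Bool, h (rowSums m x)) /
      (Fintype.card (Fin n × Fin m → Bool) : ℝ)) atTop (nhds (∫ x, h x ∂(gaussianPi n))) := by
  have hs : IsProbabilityMeasure (_root_.stdGaussian) := by unfold _root_.stdGaussian; infer_instance
  have hp : IsProbabilityMeasure (gaussianPi n) := by unfold gaussianPi; infer_instance
  let T : (Fin n → ℝ) → EuclideanSpace ℝ (Fin n) := WithLp.toLp 2
  have hT : Measurable T := (PiLp.continuous_toLp 2 _).measurable
  let P : ∀ m : ℕ, Measure (Fin n × Fin m → Bool) := fun m => (PMF.uniformOfFintype _).toMeasure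
  have hP : ∀ m, IsProbabilityMeasure (P m) := fun m => by
    simp only [P]; infer_instance
  have hS : ∀ m, Measurable (fun x : Fin n × Fin m → Bool => T (rowSums m x)) := fun m =>
    Measurable.of_discrete
  let μ : ℕ → ProbabilityMeasure (EuclideanSpace ℝ (Fin n)) := fun m =>
    ⟨(P m).map (fun x => T (rowSums m x)), Measure.isProbabilityMeasure_map (hS m).aemeasurable⟩
  let μ₀ : ProbabilityMeasure (EuclideanSpace ℝ (Fin n)) :=
    ⟨(gaussianPi n).map T, Measure.isProbabilityMeasure_map hT.aemeasurable⟩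
  have key : Tendsto μ atTop (nhds μ₀) := by
    refine ProbabilityMeasure.tendsto_of_tendsto_charFun fun t => ?_
    have e0 : charFun (μ₀ : Measure (EuclideanSpace ℝ (Fin n))) t =
        ∏ i, Complex.exp (-(t i : ℂ) ^ 2 / 2) := by
      change charFun ((Measure.pi fun _ => _root_.stdGaussian).map T) t = _
      rw [charFun_pi]
      refine Finset.prod_congr rfl fun i _ => ?_
      unfold _root_.stdGaussian
      rw [charFun_gaussianReal]
      simp [neg_div]
    rw [e0]
    refine (tendsto_finsetProd Finset.univ fun i _ => tendsto_cos_pow (t i)).congr fun m => ?_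
    rw [← sum_exp_rowSums]
    change _ = charFun ((P m).map (fun x => T (rowSums m x))) t
    rw [charFun_apply, integral_map (hS m).aemeasurable (by fun_prop)]
    simp only [P]
    rw [PMF.integral_eq_sum, Finset.sum_div]
    refine Finset.sum_congr rfl fun x _ => ?_
    simp only [T, PiLp.inner_apply]
    simp [div_eq_inv_mul, mul_comm]
  rw [ProbabilityMeasure.tendsto_iff_forall_integral_tendsto] at key
  have hc' : Continuous (fun y : EuclideanSpace ℝ (Fin n) => h (WithLp.ofLp y)) :=
    hc.comp (PiLp.continuous_ofLp 2 _)
  have k := key (BoundedContinuousFunction.ofNormedAddCommGroup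
    (fun y : EuclideanSpace ℝ (Fin n) => h (WithLp.ofLp y)) hc' C (fun y => hC _))
  have e0 : ∫ y, h (WithLp.ofLp y) ∂((gaussianPi n).map T) = ∫ x, h x ∂(gaussianPi n) := by
    rw [integral_map hT.aemeasurable hc'.aestronglyMeasurable]
  rw [← e0]
  refine k.congr fun m => ?_
  change ∫ y, h (WithLp.ofLp y) ∂((P m).map (fun x => T (rowSums m x))) = _
  rw [integral_map (hS m).aemeasurable hc'.aestronglyMeasurable]
  simp only [P]
  rw [PMF.integral_eq_sum, Finset.sum_div]
  refine Finset.sum_congr rfl fun x _ => ?_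
  simp [T, div_eq_inv_mul]

lemma continuous_pderiv {n : ℕ} (i : Fin n) (f : (Fin n → ℝ) → ℝ) (hf : ContDiff ℝ 1 f) :
    Continuous (pderiv f i) :=
  (hf.continuous_fderiv (by norm_num)).clm_apply continuous_const

lemma mvt_bound {n : ℕ} (i : Fin n) (f : (Fin n → ℝ) → ℝ) (hf : ContDiff ℝ 1 f)
    (y : Fin n → ℝ) (θ η : ℝ)
    (h : ∀ s : ℝ, |s| ≤ |θ| → |pderiv f i (y + s • Pi.single i 1) - pderiv f i y| ≤ η) :
    |f (y + θ • Pi.single i 1) - f y - θ * pderiv f i y| ≤ η * |θ| := by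
  have hd : ∀ s : ℝ, HasDerivAt (fun s : ℝ => f (y + s • Pi.single i 1) - s * pderiv f i y)
      (pderiv f i (y + s • Pi.single i 1) - pderiv f i y) s := by
    intro s
    have h1 : HasDerivAt (fun s : ℝ => y + s • (Pi.single i 1 : Fin n → ℝ)) (Pi.single i 1) s := by
      simpa using ((hasDerivAt_id s).smul_const (Pi.single i 1 : Fin n → ℝ)).const_add y
    have h2 := ((hf.differentiable (by norm_num)) (y + s • Pi.single i 1)).hasFDerivAt
    have h3 := h2.comp_hasDerivAt s h1
    have h4 : HasDerivAt (fun s : ℝ => s * pderiv f i y) (pderiv f i y) s := by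
      simpa using (hasDerivAt_id s).mul_const (pderiv f i y)
    exact h3.sub h4
  have := (convex_closedBall (0:ℝ) |θ|).norm_image_sub_le_of_norm_hasDerivWithin_le
    (f := fun s : ℝ => f (y + s • Pi.single i 1) - s * pderiv f i y)
    (f' := fun s => pderiv f i (y + s • Pi.single i 1) - pderiv f i y) (C := η) (x := 0) (y := θ)
    (fun s _ => (hd s).hasDerivWithinAt)
    (fun s hs => h s (by simpa using hs)) (by simp) (by simp)
  simp only [zero_smul, add_zero, zero_mul, sub_zero, Real.norm_eq_abs] at this
  convert this using 2
  ring

lemma rowSums_update {n m : ℕ} (i : Fin n) (j : Fin m) (x : Fin n × Fin m → Bool) :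
    rowSums m (Function.update x (i, j) (!x (i, j))) =
      rowSums m x + (-2 * pm1 (x (i, j)) / Real.sqrt m) • Pi.single i (1:ℝ) := by
  ext k
  by_cases hk : k = i
  · subst hk
    have hn : pm1 (!x (k, j)) = - pm1 (x (k, j)) := by cases x (k, j) <;> simp [pm1]
    have : ∑ l, pm1 (Function.update x (k, j) (!x (k, j)) (k, l)) =
        ∑ l, pm1 (x (k, l)) + (-2 * pm1 (x (k, j))) := by
      rw [← Finset.add_sum_erase _ _ (Finset.mem_univ j),
        ← Finset.add_sum_erase (a := j) _ (fun l => pm1 (x (k, l))) (Finset.mem_univ j)]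
      rw [Finset.sum_congr rfl (g := fun l => pm1 (x (k, l)))]
      · simp [hn]; ring
      · intro l hl
        have : l ≠ j := Finset.ne_of_mem_erase hl
        rw [Function.update_of_ne]
        simpa using this
    simp only [rowSums, this, Pi.add_apply, Pi.smul_apply, Pi.single_eq_same, smul_eq_mul]
    ring
  · simp [rowSums, hk]

/-- Continuous cutoff. -/
noncomputable def cutoff {n : ℕ} (R : ℝ) (y : Fin n → ℝ) : ℝ := min 1 (max 0 (‖y‖ - R))

lemma continuous_cutoff {n : ℕ} (R : ℝ) : Continuous (cutoff (n := n) R) := by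
  unfold cutoff; fun_prop

lemma cutoff_nonneg {n : ℕ} (R : ℝ) (y : Fin n → ℝ) : 0 ≤ cutoff R y := by
  unfold cutoff; positivity

lemma cutoff_abs_le {n : ℕ} (R : ℝ) (y : Fin n → ℝ) : |cutoff R y| ≤ 1 := by
  rw [abs_of_nonneg (cutoff_nonneg R y)]; exact min_le_left _ _

lemma cutoff_integral_tendsto (n : ℕ) :
    Tendsto (fun R : ℕ => ∫ y, cutoff (R : ℝ) y ∂(gaussianPi n)) atTop (nhds 0) := by
  have hs : IsProbabilityMeasure (_root_.stdGaussian) := by unfold _root_.stdGaussian; infer_instance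
  have hp : IsProbabilityMeasure (gaussianPi n) := by unfold gaussianPi; infer_instance
  have := tendsto_integral_of_dominated_convergence (μ := gaussianPi n)
    (F := fun (R : ℕ) y => cutoff (R : ℝ) y) (f := fun _ => 0) (fun _ => 1)
    (fun R => (continuous_cutoff _).aestronglyMeasurable) (integrable_const _)
    (fun R => ae_of_all _ fun y => cutoff_abs_le _ y)
    (ae_of_all _ fun y => by
      refine tendsto_const_nhds.congr' ?_
      filter_upwards [tendsto_natCast_atTop_atTop.eventually_ge_atTop ‖y‖] with R hR
      simp [cutoff, hR])
  simpa using this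

lemma influence_lim {n : ℕ} (i : Fin n) (f : (Fin n → ℝ) → ℝ) (hf : ContDiff ℝ 1 f)
    (C : ℝ) (hC : ∀ x, |pderiv f i x| ≤ C) (ε : ℝ) (hε : 0 < ε) :
    ∀ᶠ m : ℕ in atTop, ∀ j : Fin m,
      |Real.sqrt m * discInfluence (cubeApprox f m) (i, j) -
        2 * ∫ x, |pderiv f i x| ∂(gaussianPi n)| ≤ ε := by
  have hC0 : 0 ≤ C := (abs_nonneg _).trans (hC 0)
  have hcont := continuous_pderiv i f hf
  obtain ⟨R, hR⟩ := ((cutoff_integral_tendsto n).eventually_lt_const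
    (show 0 < ε / (16 * (C + 1)) by positivity)).exists
  have hcut := (weak_conv n _ (continuous_cutoff (R : ℝ)) 1 (cutoff_abs_le _)).eventually_lt_const hR
  have hmain := (weak_conv n (fun x => |pderiv f i x|) hcont.abs C
    (fun x => by rw [abs_abs]; exact hC x))
  have hmain' := Metric.tendsto_nhds.1 hmain (ε / 8) (by positivity)
  have huc := (isCompact_closedBall (0 : Fin n → ℝ) (R + 2)).uniformContinuousOn_of_continuous
    hcont.continuousOn
  rw [Metric.uniformContinuousOn_iff] at huc
  obtain ⟨δ, hδ, huc⟩ := huc (ε / 8) (by positivity)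
  have hm0 : Tendsto (fun m : ℕ => 2 / Real.sqrt m) atTop (nhds 0) :=
    tendsto_const_nhds.div_atTop (Real.tendsto_sqrt_atTop.comp tendsto_natCast_atTop_atTop)
  filter_upwards [hcut, hmain', hm0.eventually_lt_const (lt_min hδ one_pos),
    eventually_gt_atTop 0] with m h1 h2 h3 hm j
  have hsq : 0 < Real.sqrt m := Real.sqrt_pos.2 (by exact_mod_cast hm)
  have hcard : (0:ℝ) < Fintype.card (Fin n × Fin m → Bool) := by
    exact_mod_cast Fintype.card_pos
  -- pointwise bound
  have hpt : ∀ x : Fin n × Fin m → Bool,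
      |Real.sqrt m * |cubeApprox f m x - cubeApprox f m (Function.update x (i, j) (!x (i, j)))|
        - 2 * (|pderiv f i (rowSums m x)|)| ≤ ε / 4 + 4 * C * cutoff (R : ℝ) (rowSums m x) := by
    intro x
    set y := rowSums m x with hy
    set θ := -2 * pm1 (x (i, j)) / Real.sqrt m with hθ
    have hpm : |pm1 (x (i, j))| = 1 := by cases x (i, j) <;> simp [pm1]
    have hθa : |θ| = 2 / Real.sqrt m := by
      rw [hθ, abs_div, abs_mul, hpm, abs_of_pos hsq]; norm_num
    have e1 : cubeApprox f m x = f y := rfl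
    have e2 : cubeApprox f m (Function.update x (i, j) (!x (i, j))) = f (y + θ • Pi.single i 1) := by
      change f (rowSums m (Function.update x (i, j) (!x (i, j)))) = _
      rw [rowSums_update]
    have hb := mvt_bound i f hf y θ (ε / 8 + 2 * C * cutoff (R : ℝ) y) (by
      intro s hs
      rw [hθa] at hs
      by_cases hyR : ‖y‖ ≤ R + 1
      · have hn : ‖s • (Pi.single i 1 : Fin n → ℝ)‖ = |s| := by
          rw [norm_smul, Real.norm_eq_abs, Pi.norm_single]; simp
        have hs1 : |s| < 1 := hs.trans_lt (h3.trans_le (min_le_right _ _))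
        have := huc (y + s • Pi.single i 1) (by
          rw [mem_closedBall_zero_iff]
          refine (norm_add_le _ _).trans ?_
          rw [hn]; linarith) y (by rw [mem_closedBall_zero_iff]; linarith)
          (by rw [dist_eq_norm, add_sub_cancel_left, hn]
              exact hs.trans_lt (h3.trans_le (min_le_left _ _)))
        rw [Real.dist_eq] at this
        have := mul_nonneg (mul_nonneg zero_le_two hC0) (cutoff_nonneg (R : ℝ) y)
        linarith
      · have hc1 : cutoff (R : ℝ) y = 1 := by
          unfold cutoff
          exact min_eq_left (le_max_of_le_right (by linarith))
        rw [hc1]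
        have a1 := hC (y + s • Pi.single i 1)
        have a2 := hC y
        have := abs_sub (pderiv f i (y + s • Pi.single i 1)) (pderiv f i y)
        linarith)
    rw [e1, e2, abs_sub_comm (f y)]
    have hb2 : |(|f (y + θ • Pi.single i 1) - f y| - |θ * pderiv f i y|)| ≤
        (ε / 8 + 2 * C * cutoff (R : ℝ) y) * |θ| := (abs_abs_sub_abs_le _ _).trans hb
    rw [abs_mul, hθa] at hb2
    have e3 : Real.sqrt m * |f (y + θ • Pi.single i 1) - f y| - 2 * |pderiv f i y| =
        Real.sqrt m * (|f (y + θ • Pi.single i 1) - f y| - 2 / Real.sqrt m * |pderiv f i y|) := by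
      field_simp
    rw [e3, abs_mul, abs_of_pos hsq]
    calc _ ≤ Real.sqrt m * ((ε / 8 + 2 * C * cutoff (R : ℝ) y) * (2 / Real.sqrt m)) := by gcongr
      _ = _ := by field_simp; ring
  have hsum : |Real.sqrt m * discInfluence (cubeApprox f m) (i, j) -
      2 * ((∑ x : Fin n × Fin m → Bool, |pderiv f i (rowSums m x)|) /
        (Fintype.card (Fin n × Fin m → Bool) : ℝ))| ≤
      ε / 4 + 4 * C * ((∑ x : Fin n × Fin m → Bool, cutoff (R : ℝ) (rowSums m x)) /
        (Fintype.card (Fin n × Fin m → Bool) : ℝ)) := by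
    unfold discInfluence
    rw [← mul_div_assoc, ← mul_div_assoc, ← sub_div, Finset.mul_sum, Finset.mul_sum,
      ← Finset.sum_sub_distrib, abs_div, abs_of_pos hcard, div_le_iff₀ hcard, add_mul, mul_assoc,
      div_mul_cancel₀ _ hcard.ne']
    refine (Finset.abs_sum_le_sum_abs _ _).trans ((Finset.sum_le_sum fun x _ => hpt x).trans ?_)
    rw [Finset.sum_add_distrib, ← Finset.mul_sum, Finset.sum_const, Finset.card_univ, nsmul_eq_mul]
    apply le_of_eq; ring
  rw [Real.dist_eq] at h2
  have h4 : 4 * C * ((∑ x : Fin n × Fin m → Bool, cutoff (R : ℝ) (rowSums m x)) /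
        (Fintype.card (Fin n × Fin m → Bool) : ℝ)) ≤ ε / 4 := by
    calc _ ≤ 4 * C * (ε / (16 * (C + 1))) := by gcongr
      _ = ε / 4 * (C / (C + 1)) := by field_simp; ring
      _ ≤ ε / 4 * 1 := by
        gcongr
        rw [div_le_one (by positivity)]; linarith
      _ = _ := mul_one _
  rw [abs_le] at hsum ⊢
  rw [abs_lt] at h2
  constructor <;> linarith [hsum.1, hsum.2, h2.1, h2.2]

/-- **Lemma (influence products of discretizations converge).**
Fix `n ≥ 1` and `i`. If `f, g : ℝⁿ → ℝ` are `C¹` with bounded `i`-th partial derivatives,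
then `∑_{j=1}^m I_{ij}(f̌_m)·I_{ij}(ǧ_m) → 4·E_μ[|∂_i f|]·E_μ[|∂_i g|]` as `m → ∞`. -/
theorem influence_product_tendsto
    (n : ℕ) (hn : 1 ≤ n) (i : Fin n) (f g : (Fin n → ℝ) → ℝ)
    (hf : ContDiff ℝ 1 f) (hg : ContDiff ℝ 1 g)
    (Cf : ℝ) (hCf : ∀ x, |pderiv f i x| ≤ Cf)
    (Cg : ℝ) (hCg : ∀ x, |pderiv g i x| ≤ Cg) :
    Filter.Tendsto
      (fun m : ℕ => ∑ j : Fin m,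
        discInfluence (cubeApprox f m) (i, j) * discInfluence (cubeApprox g m) (i, j))
      Filter.atTop
      (nhds (4 * (∫ x, |pderiv f i x| ∂(gaussianPi n)) *
        (∫ x, |pderiv g i x| ∂(gaussianPi n)))) := by
  set A := 2 * ∫ x, |pderiv f i x| ∂(gaussianPi n) with hA
  set B := 2 * ∫ x, |pderiv g i x| ∂(gaussianPi n) with hB
  have hAB : 4 * (∫ x, |pderiv f i x| ∂(gaussianPi n)) *
        (∫ x, |pderiv g i x| ∂(gaussianPi n)) = A * B := by rw [hA, hB]; ring
  rw [hAB, Metric.tendsto_nhds]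
  intro ε hε
  set D := |A| + |B| + 1 with hD
  have hD0 : 0 < D := by positivity
  set η := min 1 (ε / (2 * D)) with hη
  have hη0 : 0 < η := lt_min one_pos (by positivity)
  have hη1 : η ≤ 1 := min_le_left _ _
  have hη2 : η * D ≤ ε / 2 := by
    calc η * D ≤ ε / (2 * D) * D := by gcongr; exact min_le_right _ _
      _ = ε / 2 := by field_simp
  filter_upwards [influence_lim i f hf Cf hCf η hη0, influence_lim i g hg Cg hCg η hη0,
    eventually_gt_atTop 0] with m h1 h2 hm
  have hm' : (0:ℝ) < m := by exact_mod_cast hm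
  have hs : Real.sqrt m * Real.sqrt m = m := Real.mul_self_sqrt hm'.le
  have hj : ∀ j : Fin m, |m * (discInfluence (cubeApprox f m) (i, j) *
      discInfluence (cubeApprox g m) (i, j)) - A * B| ≤ ε / 2 := by
    intro j
    have a1 := h1 j
    have a2 := h2 j
    rw [← hA] at a1
    rw [← hB] at a2
    set a := Real.sqrt m * discInfluence (cubeApprox f m) (i, j)
    set b := Real.sqrt m * discInfluence (cubeApprox g m) (i, j)
    have e : m * (discInfluence (cubeApprox f m) (i, j) *
      discInfluence (cubeApprox g m) (i, j)) - A * B =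
        (a - A) * (b - B) + (a - A) * B + A * (b - B) := by
      have : (m : ℝ) * (discInfluence (cubeApprox f m) (i, j) *
        discInfluence (cubeApprox g m) (i, j)) = a * b := by
        rw [← hs]; simp only [a, b]; ring
      rw [this]; ring
    rw [e]
    calc _ ≤ |(a - A) * (b - B)| + |(a - A) * B| + |A * (b - B)| := abs_add_three _ _ _
      _ = |a - A| * |b - B| + |a - A| * |B| + |A| * |b - B| := by simp only [abs_mul]
      _ ≤ η * 1 + η * |B| + |A| * η := by
        gcongr
        exact a2.trans hη1
      _ = η * D := by rw [hD]; ring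
      _ ≤ _ := hη2
  rw [Real.dist_eq]
  have e : ∑ j : Fin m, discInfluence (cubeApprox f m) (i, j) *
      discInfluence (cubeApprox g m) (i, j) - A * B =
      (∑ j : Fin m, (m * (discInfluence (cubeApprox f m) (i, j) *
      discInfluence (cubeApprox g m) (i, j)) - A * B)) / m := by
    rw [Finset.sum_sub_distrib, ← Finset.mul_sum, Finset.sum_const, Finset.card_univ,
      Fintype.card_fin, nsmul_eq_mul]
    field_simp
  rw [e, abs_div, abs_of_pos hm', div_lt_iff₀ hm']
  calc _ ≤ ∑ j : Fin m, ε / 2 :=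
        (Finset.abs_sum_le_sum_abs _ _).trans (Finset.sum_le_sum fun j _ => hj j)
    _ = ε / 2 * m := by simp [mul_comm]
    _ < ε * m := by gcongr; linarith
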